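/- Let p ≥ 2, d₂ ≥ 1, and Γ = pℤ × ℤ^{d₂} ⊂ ℤ^{1+d₂}. Let H_{0,Γ^c} be the discrete Laplacian on ℓ²(Γ^c) with simple boundary conditions. Then σ(H_{0,Γ^c}) = ⋃_{ℓ=1}^{p−1} (2cos(πℓ/p) + [−2d₂, 2d₂]). -/

import Mathlib

open scoped Classical

open Polynomial Polynomial.Chebyshev

/-- A polynomial in `D + A` is, modulo a right multiple of `D`, the same polynomial in `A`. -/
theorem exists_aeval_add_eq {R : Type*} [Ring R] [Algebra ℝ R] {D A : R} (h : Commute D A)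
    (q : ℝ[X]) : ∃ Q, Commute D Q ∧ aeval (D + A) q = D * Q + aeval A q := by
  induction q using Polynomial.induction_on with
  | C a => exact ⟨0, Commute.zero_right D, by simp⟩
  | add f g hf hg =>
    obtain ⟨F, hF, hf⟩ := hf
    obtain ⟨G, hG, hg⟩ := hg
    refine ⟨F + G, hF.add_right hG, ?_⟩
    rw [map_add, map_add, hf, hg, mul_add]
    abel
  | monomial n a ih =>
    obtain ⟨Q, hQ, ih⟩ := ih
    have hA : Commute D (aeval A (C a * X ^ n)) := by
      simpa using (Algebra.commute_algebraMap_right a D).mul_right (h.pow_right n)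
    refine ⟨Q * (D + A) + aeval A (C a * X ^ n),
      (hQ.mul_right ((Commute.refl D).add_right h)).add_right hA, ?_⟩
    rw [pow_succ, ← mul_assoc, map_mul _ _ X, map_mul _ _ X, ih, aeval_X, aeval_X]
    rw [add_mul, mul_add (aeval A _), ← hA.eq, mul_add D, mul_assoc]
    abel

/-- If `A` is annihilated by a split polynomial, `B` commutes with `A` and no root of this
polynomial lies in the spectrum of `B`, then `B - A` is invertible. -/
theorem isUnit_sub_of_aeval_eq_zero {R : Type*} [Ring R] [Algebra ℝ R] {B A : R}
    (h : Commute B A) {q : ℝ[X]} (hq : q.Splits) (hq0 : q ≠ 0) (hA : aeval A q = 0)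
    (hB : ∀ r ∈ q.roots, IsUnit (B - algebraMap ℝ R r)) : IsUnit (B - A) := by
  have hD : Commute (B - A) A := h.sub_left (Commute.refl A)
  obtain ⟨Q, hQ, e⟩ := exists_aeval_add_eq hD q
  rw [hA, add_zero, sub_add_cancel] at e
  have key : ∀ s : Multiset ℝ, (∀ r ∈ s, IsUnit (B - algebraMap ℝ R r)) →
      IsUnit (aeval B (s.map fun r => X - Polynomial.C r).prod) := by
    intro s
    induction s using Multiset.induction_on with
    | empty => simp
    | cons a s ih =>
      intro hs
      rw [Multiset.map_cons, Multiset.prod_cons, map_mul]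
      refine IsUnit.mul ?_ (ih fun r hr => hs r (Multiset.mem_cons_of_mem hr))
      simpa using hs a (Multiset.mem_cons_self a s)
  have hu : IsUnit (aeval B q) := by
    rw [hq.eq_prod_roots, map_mul, Polynomial.aeval_C]
    exact ((IsUnit.mk0 _ (leadingCoeff_ne_zero.2 hq0)).map _).mul (key _ hB)
  rw [e, hQ.isUnit_mul_iff] at hu
  exact hu.1

theorem splits_U_real (n : ℕ) : (U ℝ n).Splits := by
  rw [splits_iff_card_roots, roots_U_real, natDegree_U_natCast, Finset.card_val,
    Finset.card_image_of_injOn, Finset.card_range]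
  exact (Finset.range n).nodup_map_iff_injOn.mp (roots_U_real_nodup n)

/-- Composition with an injective map, as an operator on `ℓ²`. -/
noncomputable def lpCompCLM {α : Type*} (e : α → α) (he : Function.Injective e) :
    lp (fun _ : α => ℝ) 2 →L[ℝ] lp (fun _ : α => ℝ) 2 :=
  LinearMap.mkContinuous
    { toFun := fun u => ⟨fun x => u (e x), by
        have h := lp.memℓp u
        change Memℓp _ _
        rw [memℓp_gen_iff (by simp)] at h ⊢
        exact h.comp_injective he⟩
      map_add' := fun _ _ => rfl
      map_smul' := fun _ _ => rfl } 1 fun u => by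
    rw [one_mul]
    refine lp.norm_le_of_forall_sum_le (by simp) (norm_nonneg u) fun s => ?_
    have := lp.sum_rpow_le_norm_rpow (p := 2) (by simp) u (s.image e)
    rwa [Finset.sum_image he.injOn] at this

@[simp]
theorem lpCompCLM_apply {α : Type*} (e : α → α) (he : Function.Injective e)
    (u : lp (fun _ : α => ℝ) 2) (x : α) : lpCompCLM e he u x = u (e x) := rfl

theorem norm_lpCompCLM_le {α : Type*} (e : α → α) (he : Function.Injective e) :
    ‖lpCompCLM e he‖ ≤ 1 :=
  LinearMap.mkContinuous_norm_le _ zero_le_one _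

/-- The complement of `pℤ × ℤ^d`. -/
abbrev TrimmedSite (p d : ℕ) := {z : ℤ × (Fin d → ℤ) // ¬ (p : ℤ) ∣ z.1}

/-- The Hilbert space `ℓ²` of the complement of `pℤ × ℤ^d`. -/
abbrev TrimmedSpace (p d : ℕ) := lp (fun _ : TrimmedSite p d => ℝ) 2

section

variable {p d : ℕ}

/-- Extension of a function on the trimmed lattice by zero. -/
noncomputable def extendZero (u : TrimmedSite p d → ℝ) (n : ℤ) (y : Fin d → ℤ) : ℝ :=
  if h : ¬ (p : ℤ) ∣ n then u ⟨(n, y), h⟩ else 0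

theorem extendZero_of_not_dvd (u : TrimmedSite p d → ℝ) {n : ℤ} (h : ¬ (p : ℤ) ∣ n)
    (y : Fin d → ℤ) : extendZero u n y = u ⟨(n, y), h⟩ := dif_pos h

theorem extendZero_of_dvd (u : TrimmedSite p d → ℝ) {n : ℤ} (h : (p : ℤ) ∣ n)
    (y : Fin d → ℤ) : extendZero u n y = 0 := dif_neg (not_not.2 h)

/-- The operator `H` acts as the Laplacian with simple boundary conditions. -/
def IsTrimmedLaplacian (H : TrimmedSpace p d →L[ℝ] TrimmedSpace p d) : Prop :=
  ∀ (u : TrimmedSpace p d) (x : TrimmedSite p d),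
    H u x = extendZero u (x.1.1 + 1) x.1.2 + extendZero u (x.1.1 - 1) x.1.2 +
      ∑ k : Fin d, (u ⟨(x.1.1, x.1.2 + Pi.single k 1), x.2⟩ +
        u ⟨(x.1.1, x.1.2 + Pi.single k (-1)), x.2⟩)

/-- Translation of the untrimmed coordinates. -/
def trimmedShift (v : Fin d → ℤ) (x : TrimmedSite p d) : TrimmedSite p d :=
  ⟨(x.1.1, x.1.2 + v), x.2⟩

theorem trimmedShift_injective (v : Fin d → ℤ) :
    Function.Injective (trimmedShift (p := p) v) := by
  rintro ⟨⟨n, y⟩, hx⟩ ⟨⟨m, z⟩, hz⟩ h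
  simpa [trimmedShift] using h

/-- The translation operator on the untrimmed coordinates. -/
noncomputable def trimmedShiftCLM (p : ℕ) {d : ℕ} (v : Fin d → ℤ) :
    TrimmedSpace p d →L[ℝ] TrimmedSpace p d :=
  lpCompCLM (trimmedShift v) (trimmedShift_injective v)

/-- The Laplacian in the untrimmed directions. -/
noncomputable def transverseLaplacian (p d : ℕ) : TrimmedSpace p d →L[ℝ] TrimmedSpace p d :=
  ∑ k : Fin d, (trimmedShiftCLM p (Pi.single k 1) + trimmedShiftCLM p (Pi.single k (-1)))

theorem transverseLaplacian_apply (u : TrimmedSpace p d) (x : TrimmedSite p d) :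
    transverseLaplacian p d u x = ∑ k : Fin d, (u ⟨(x.1.1, x.1.2 + Pi.single k 1), x.2⟩ +
      u ⟨(x.1.1, x.1.2 + Pi.single k (-1)), x.2⟩) := by
  rw [transverseLaplacian, _root_.sum_apply, lp.coeFn_sum, Finset.sum_apply]
  rfl

theorem norm_transverseLaplacian_le : ‖transverseLaplacian p d‖ ≤ 2 * d := by
  refine (norm_sum_le_of_le (n := fun _ => (2 : ℝ)) _ fun k _ => ?_).trans
    (le_of_eq (by simp [mul_comm]))
  refine (norm_add_le _ _).trans ?_
  have h₁ := norm_lpCompCLM_le _ (trimmedShift_injective (p := p) (Pi.single k 1 : Fin d → ℤ))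
  have h₂ := norm_lpCompCLM_le _ (trimmedShift_injective (p := p) (Pi.single k (-1) : Fin d → ℤ))
  exact (add_le_add h₁ h₂).trans (by norm_num)

theorem extendZero_trimmedShiftCLM (u : TrimmedSpace p d) (v : Fin d → ℤ) (n : ℤ)
    (y : Fin d → ℤ) : extendZero (trimmedShiftCLM p v u) n y = extendZero u n (y + v) := rfl

namespace IsTrimmedLaplacian

variable {H : TrimmedSpace p d →L[ℝ] TrimmedSpace p d}

theorem commute_trimmedShiftCLM (hH : IsTrimmedLaplacian H) (v : Fin d → ℤ) :
    Commute H (trimmedShiftCLM p v) := by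
  ext u x
  change H (trimmedShiftCLM p v u) x = H u (trimmedShift v x)
  rw [hH, hH, extendZero_trimmedShiftCLM, extendZero_trimmedShiftCLM]
  simp only [trimmedShiftCLM, lpCompCLM_apply, trimmedShift, add_right_comm]

theorem commute_transverseLaplacian (hH : IsTrimmedLaplacian H) :
    Commute H (transverseLaplacian p d) :=
  Commute.sum_right _ _ _ fun _ _ =>
    (hH.commute_trimmedShiftCLM _).add_right (hH.commute_trimmedShiftCLM _)

theorem sub_transverseLaplacian_apply (hH : IsTrimmedLaplacian H) (u : TrimmedSpace p d)
    (x : TrimmedSite p d) : (H - transverseLaplacian p d) u x =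
      extendZero u (x.1.1 + 1) x.1.2 + extendZero u (x.1.1 - 1) x.1.2 := by
  rw [_root_.sub_apply, lp.coeFn_sub, Pi.sub_apply, hH, transverseLaplacian_apply,
    add_sub_cancel_right]

/-- The Chebyshev polynomial of index `k` moves the first value of a block to position `k + 1`. -/
theorem aeval_U_apply (hH : IsTrimmedLaplacian H) (hp : 2 ≤ p) (k : ℕ) (hk : k < p)
    (u : TrimmedSpace p d) (b : ℤ) (y : Fin d → ℤ) :
    extendZero (aeval ((1 / 2 : ℝ) • (H - transverseLaplacian p d)) (U ℝ k) u) (p * b + 1) y =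
      extendZero u (p * b + 1 + k) y := by
  have hnd : ∀ j : ℕ, j + 1 < p → ¬ (p : ℤ) ∣ p * b + 1 + j := by
    intro j hj h
    rw [add_assoc, dvd_add_right (dvd_mul_right _ _)] at h
    have := Int.le_of_dvd (by omega) h
    omega
  have hA : ∀ (w : TrimmedSpace p d) (j : ℕ), j + 1 < p →
      extendZero ((H - transverseLaplacian p d) w) (p * b + 1 + j) y =
        extendZero w (p * b + 1 + j + 1) y + extendZero w (p * b + 1 + j - 1) y := by
    intro w j hj
    rw [extendZero_of_not_dvd _ (hnd j hj), hH.sub_transverseLaplacian_apply]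
  have h0 : ¬ (p : ℤ) ∣ p * b + 1 := by simpa using hnd 0 (by omega)
  set A := H - transverseLaplacian p d
  induction k using Nat.twoStepInduction generalizing u with
  | zero => simp
  | one =>
    have := hA u 0 (by omega)
    simp only [Nat.cast_zero, add_zero, add_sub_cancel_right,
      extendZero_of_dvd _ (dvd_mul_right (p : ℤ) b)] at this
    have e : aeval ((1 / 2 : ℝ) • A) (U ℝ (1 : ℕ)) = A := by
      simp [Chebyshev.U_one, two_mul, ← add_smul]
      norm_num
    rw [e, this]
    simp
  | more k ih₁ ih₂ =>
    have e : aeval ((1 / 2 : ℝ) • A) (U ℝ ((k + 2 : ℕ) : ℤ)) u =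
        aeval ((1 / 2 : ℝ) • A) (U ℝ ((k + 1 : ℕ) : ℤ)) (A u) -
          aeval ((1 / 2 : ℝ) • A) (U ℝ (k : ℤ)) u := by
      have : aeval ((1 / 2 : ℝ) • A) (2 * X : ℝ[X]) = A := by
        simp [two_mul, ← add_smul]
        norm_num
      push_cast
      rw [U_add_two, mul_comm, map_sub, map_mul, this]
      rfl
    have hsub : ∀ w₁ w₂ : TrimmedSpace p d, extendZero (w₁ - w₂ : TrimmedSpace p d) (p * b + 1) y =
        extendZero w₁ (p * b + 1) y - extendZero w₂ (p * b + 1) y := fun w₁ w₂ => by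
      simp only [extendZero_of_not_dvd _ h0]
      rfl
    rw [e, hsub, ih₁ (by omega), ih₂ (by omega), hA _ _ (by omega)]
    push_cast
    rw [show (p * b + 1 + (k + 1) - 1 : ℤ) = p * b + 1 + k by ring, add_sub_cancel_right]
    congr 1
    ring

theorem aeval_U_eq_zero (hH : IsTrimmedLaplacian H) (hp : 2 ≤ p) :
    aeval ((1 / 2 : ℝ) • (H - transverseLaplacian p d)) (U ℝ (p - 1 : ℕ)) = 0 := by
  ext u x
  obtain ⟨⟨n, y⟩, hx⟩ := x
  obtain ⟨k, hk⟩ : ∃ k : ℕ, n % p = k + 1 := by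
    have h1 := Int.emod_nonneg n (b := p) (by omega)
    have h2 : n % p ≠ 0 := fun h => hx (Int.dvd_of_emod_eq_zero h)
    exact ⟨(n % p - 1).toNat, by omega⟩
  have hkp : k < p := by
    have := Int.emod_lt_of_pos n (b := p) (by omega)
    omega
  have hn : n = p * (n / p) + 1 + k := by
    have := Int.mul_ediv_add_emod n p
    omega
  set A := (1 / 2 : ℝ) • (H - transverseLaplacian p d) with hA
  have key : extendZero (aeval A (U ℝ (p - 1 : ℕ)) u) n y = 0 := by
    rw [hn, ← hH.aeval_U_apply hp k hkp, ← mul_apply_eq_comp, ← map_mul, mul_comm,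
      map_mul, mul_apply_eq_comp, ← hA, hH.aeval_U_apply hp (p - 1) (by omega)]
    apply extendZero_of_dvd
    exact ⟨n / p + 1, by push_cast [show 1 ≤ p by omega]; ring⟩
  rwa [extendZero_of_not_dvd _ hx] at key

theorem spectrum_subset (hH : IsTrimmedLaplacian H) (hp : 2 ≤ p) :
    spectrum ℝ H ⊆ ⋃ ℓ ∈ Finset.Icc 1 (p - 1),
      Set.Icc (2 * Real.cos (Real.pi * ℓ / p) - 2 * d)
              (2 * Real.cos (Real.pi * ℓ / p) + 2 * d) := by
  intro t ht
  by_contra hnot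
  apply ht
  set B := transverseLaplacian p d
  have hc : Commute ((1 / 2 : ℝ) • (algebraMap ℝ _ t - B)) ((1 / 2 : ℝ) • (H - B)) := by
    refine (Commute.smul_left ?_ _).smul_right _
    exact (Algebra.commute_algebraMap_left t _).sub_left
      (hH.commute_transverseLaplacian.symm.sub_right (Commute.refl B))
  have hU := isUnit_sub_of_aeval_eq_zero hc (splits_U_real (p - 1))
    (U_ne_zero ℝ _ (by omega)) (hH.aeval_U_eq_zero hp) ?_
  · rw [← smul_sub, sub_sub_sub_cancel_right] at hU
    have := hU.smul (Units.mk0 (2 : ℝ) two_ne_zero)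
    rwa [Units.smul_mk0, smul_smul, mul_one_div_cancel two_ne_zero, one_smul] at this
  · intro r hr
    rw [roots_U_real, Finset.mem_val, Finset.mem_image] at hr
    obtain ⟨k, hk, rfl⟩ := hr
    rw [Finset.mem_range] at hk
    set r := Real.cos ((k + 1) * Real.pi / ((p - 1 : ℕ) + 1))
    have hr : r = Real.cos (Real.pi * (k + 1 : ℕ) / p) := by
      simp only [r]
      congr 1
      push_cast [show 1 ≤ p by omega]
      ring
    have hlt : 2 * (d : ℝ) < |t - 2 * r| := by
      by_contra! hle
      refine hnot (Set.mem_biUnion (x := k + 1) (by simp; omega) ?_)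
      rw [← hr]
      rw [abs_le] at hle
      constructor <;> linarith
    have hunit : IsUnit
        (algebraMap ℝ (TrimmedSpace p d →L[ℝ] TrimmedSpace p d) (t - 2 * r) - B) := by
      apply spectrum.mem_resolventSet_of_norm_lt_mul
      rw [Real.norm_eq_abs]
      refine lt_of_le_of_lt ?_ hlt
      calc ‖B‖ * ‖(1 : TrimmedSpace p d →L[ℝ] TrimmedSpace p d)‖ ≤ ‖B‖ * 1 :=
            mul_le_mul_of_nonneg_left ContinuousLinearMap.norm_id_le (norm_nonneg _)
        _ ≤ 2 * d := by rw [mul_one]; exact norm_transverseLaplacian_le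
    have := hunit.smul (Units.mk0 (1 / 2 : ℝ) (by norm_num))
    rw [Units.smul_mk0] at this
    convert this using 1
    simp only [Algebra.algebraMap_eq_smul_one]
    module

end IsTrimmedLaplacian

end

theorem summable_prod_apply {f : ℤ → ℝ} (hf : Summable f) (hf0 : 0 ≤ f) (d : ℕ) :
    Summable fun y : Fin d → ℤ => ∏ j, f (y j) := by
  induction d with
  | zero => exact Summable.of_finite
  | succ d ih =>
    have h := hf.mul_of_nonneg ih hf0 fun y => Finset.prod_nonneg fun j _ => hf0 (y j)
    rw [← (Fin.consEquiv fun _ : Fin (d + 1) => ℤ).summable_iff]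
    convert h using 2 with y
    simp [Fin.prod_univ_succ, Fin.consEquiv]

theorem summable_pow_natAbs {q : ℝ} (hq0 : 0 ≤ q) (hq1 : q < 1) :
    Summable fun n : ℤ => q ^ n.natAbs := by
  refine Summable.of_nat_of_neg ?_ ?_ <;> simpa using summable_geometric_of_lt_one hq0 hq1

/-- Moving one step changes `q ^ ∑ |y j|`, with `q = (1 + δ)⁻¹`, by a factor at most `δ`. -/
theorem abs_weight_sub_le {d : ℕ} {δ : ℝ} (hδ : 0 < δ) (y v : Fin d → ℤ)
    (hv : ∑ j, (v j).natAbs ≤ 1) :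
    |((1 + δ)⁻¹) ^ (∑ j, (y j + v j).natAbs) - ((1 + δ)⁻¹) ^ (∑ j, (y j).natAbs)| ≤
      δ * ((1 + δ)⁻¹) ^ (∑ j, (y j).natAbs) := by
  set a := ∑ j, (y j + v j).natAbs
  set b := ∑ j, (y j).natAbs
  have h₁ : a ≤ b + 1 := (Finset.sum_le_sum fun j _ => Int.natAbs_add_le (y j) (v j)).trans (by
    rw [Finset.sum_add_distrib]; omega)
  have h₂ : b ≤ a + 1 := by
    have : b ≤ ∑ j, ((y j + v j).natAbs + (v j).natAbs) :=
      Finset.sum_le_sum fun j _ => by omega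
    rw [Finset.sum_add_distrib] at this
    omega
  have hq1 : (1 + δ)⁻¹ ≤ 1 := inv_le_one_of_one_le₀ (by linarith)
  have hq0 : 0 ≤ (1 + δ)⁻¹ := by positivity
  have hδq : (1 + δ) * (1 + δ)⁻¹ = 1 := mul_inv_cancel₀ (by positivity)
  have key : ∀ m n : ℕ, m ≤ n + 1 → ((1 + δ)⁻¹) ^ n ≤ (1 + δ) * ((1 + δ)⁻¹) ^ m := by
    intro m n h
    calc ((1 + δ)⁻¹) ^ n = (1 + δ) * ((1 + δ)⁻¹) ^ (n + 1) := by
          rw [pow_succ, mul_left_comm, hδq, mul_one]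
      _ ≤ _ := mul_le_mul_of_nonneg_left (pow_le_pow_of_le_one hq0 hq1 h) (by positivity)
  have k₁ := key b a h₂
  have k₂ := key a b h₁
  have hb : 0 ≤ ((1 + δ)⁻¹) ^ b := by positivity
  have ha : 0 ≤ ((1 + δ)⁻¹) ^ a := by positivity
  rw [abs_le]
  constructor <;> nlinarith

/-- The Dirichlet eigenfunction of the block `{1, …, p - 1}`, extended by zero to `ℤ`. -/
noncomputable def blockSine (p ℓ : ℕ) (n : ℤ) : ℝ :=
  if 0 < n ∧ n < p then Real.sin (Real.pi * ℓ / p * n) else 0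

theorem blockSine_add_one_add_sub_one {p ℓ : ℕ} (hp : 0 < p) {n : ℤ} (hn : ¬ (p : ℤ) ∣ n) :
    blockSine p ℓ (n + 1) + blockSine p ℓ (n - 1) =
      2 * Real.cos (Real.pi * ℓ / p) * blockSine p ℓ n := by
  have h0 : n ≠ 0 := by rintro rfl; exact hn (dvd_zero _)
  have hpn : n ≠ p := by rintro rfl; exact hn dvd_rfl
  have hp' : (p : ℝ) ≠ 0 := by positivity
  by_cases h : 0 < n ∧ n < p
  · have hend : ∀ m : ℤ, 0 ≤ m → m ≤ p → blockSine p ℓ m = Real.sin (Real.pi * ℓ / p * m) := by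
      intro m h₁ h₂
      unfold blockSine
      split_ifs with h₃
      · rfl
      · obtain rfl | rfl : m = 0 ∨ m = p := by omega
        · simp
        · rw [Int.cast_natCast, div_mul_cancel₀ _ hp', mul_comm, Real.sin_nat_mul_pi]
    rw [hend _ (by omega) (by omega), hend _ (by omega) (by omega), hend _ (by omega) (by omega)]
    push_cast
    rw [mul_add, mul_sub, mul_one, Real.sin_add, Real.sin_sub]
    ring
  · rw [blockSine, if_neg (by omega), blockSine, if_neg (by omega), blockSine, if_neg h]
    simp

theorem blockSine_eq_zero_of_dvd {p ℓ : ℕ} {n : ℤ} (hn : (p : ℤ) ∣ n) : blockSine p ℓ n = 0 := by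
  refine if_neg fun h => ?_
  have := Int.le_of_dvd h.1 hn
  omega

theorem blockSine_one_ne_zero {p ℓ : ℕ} (hℓ : 1 ≤ ℓ) (hℓp : ℓ < p) : blockSine p ℓ 1 ≠ 0 := by
  have hp : (0 : ℝ) < p := by exact_mod_cast (by omega : 0 < p)
  rw [blockSine, if_pos (by omega)]
  refine (Real.sin_pos_of_pos_of_lt_pi ?_ ?_).ne'
  · have : (0 : ℝ) < ℓ := by exact_mod_cast hℓ
    have := Real.pi_pos
    positivity
  · rw [Int.cast_one, mul_one, div_lt_iff₀ hp]
    exact mul_lt_mul_of_pos_left (by exact_mod_cast hℓp) Real.pi_pos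

theorem summable_abs_blockSine (p ℓ : ℕ) : Summable fun n => |blockSine p ℓ n| := by
  refine summable_of_ne_finset_zero (s := Finset.Ioo 0 (p : ℤ)) fun n hn => ?_
  rw [blockSine, if_neg (by simpa using hn), abs_zero]

section

variable {p d : ℕ}

/-- The decaying profile of the approximate eigenvectors. -/
noncomputable def weylWeight (p ℓ : ℕ) (q : ℝ) (n : ℤ) (y : Fin d → ℤ) : ℝ :=
  blockSine p ℓ n * q ^ (∑ j, (y j).natAbs)

theorem memℓp_weylWeight (ℓ : ℕ) {q : ℝ} (hq0 : 0 ≤ q) (hq1 : q < 1) :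
    Memℓp (fun x : TrimmedSite p d => weylWeight p ℓ q x.1.1 x.1.2) 2 := by
  refine Memℓp.of_exponent_ge (p := 2) (q := 1) ?_ one_le_two
  rw [memℓp_gen_iff (by simp)]
  have h := (summable_abs_blockSine p ℓ).mul_of_nonneg
    (summable_prod_apply (summable_pow_natAbs hq0 hq1) (fun n => by positivity) d)
    (fun n => abs_nonneg _) fun y => Finset.prod_nonneg fun j _ => by positivity
  refine (h.comp_injective (i := fun x : TrimmedSite p d => x.1) Subtype.val_injective).congr
    fun x => ?_
  simp [weylWeight, Finset.prod_pow_eq_pow_sum, abs_of_nonneg hq0]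

namespace IsTrimmedLaplacian

variable {H : TrimmedSpace p d →L[ℝ] TrimmedSpace p d}

/-- The decaying profile modulated by a plane wave is almost an eigenvector. -/
theorem abs_sub_apply_le (hH : IsTrimmedLaplacian H) (hp : 0 < p) (ℓ : ℕ) {δ : ℝ} (hδ : 0 < δ)
    (θ α : ℝ) (u : TrimmedSpace p d)
    (hu : ∀ x, u x = weylWeight p ℓ (1 + δ)⁻¹ x.1.1 x.1.2 *
      Real.cos (θ * (∑ j, x.1.2 j : ℤ) - α)) (x : TrimmedSite p d) :
    |(algebraMap ℝ (TrimmedSpace p d →L[ℝ] TrimmedSpace p d)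
        (2 * Real.cos (Real.pi * ℓ / p) + 2 * d * Real.cos θ) - H) u x| ≤
      2 * d * δ * |weylWeight p ℓ (1 + δ)⁻¹ x.1.1 x.1.2| := by
  obtain ⟨⟨n, y⟩, hn⟩ := x
  have hext : ∀ m : ℤ, extendZero u m y = weylWeight p ℓ (1 + δ)⁻¹ m y *
      Real.cos (θ * (∑ j, y j : ℤ) - α) := by
    intro m
    by_cases hm : (p : ℤ) ∣ m
    · rw [extendZero_of_dvd _ hm, weylWeight, blockSine_eq_zero_of_dvd hm, zero_mul, zero_mul]
    · rw [extendZero_of_not_dvd _ hm, hu]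
  have h₀ : (algebraMap ℝ (TrimmedSpace p d →L[ℝ] TrimmedSpace p d)
        (2 * Real.cos (Real.pi * ℓ / p) + 2 * d * Real.cos θ) - H) u ⟨(n, y), hn⟩ =
      (2 * Real.cos (Real.pi * ℓ / p) + 2 * d * Real.cos θ) * u ⟨(n, y), hn⟩ -
        H u ⟨(n, y), hn⟩ := rfl
  have hb := blockSine_add_one_add_sub_one (ℓ := ℓ) hp hn
  rw [h₀, hH]
  dsimp only
  rw [hext, hext]
  simp only [hu, weylWeight]
  set W : (Fin d → ℤ) → ℝ := fun z => (1 + δ)⁻¹ ^ (∑ j, (z j).natAbs)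
  set s : ℤ := ∑ j, y j with hs
  set b := blockSine p ℓ n
  have hsum : ∀ (k : Fin d) (a : ℤ), ∑ j, (y + Pi.single k a : Fin d → ℤ) j = s + a := by
    intro k a
    simp [Finset.sum_add_distrib, hs]
  have hstep : ∀ (k : Fin d) (a : ℤ), a.natAbs ≤ 1 →
      |W (y + Pi.single k a) - W y| ≤ δ * W y := by
    intro k a ha
    refine abs_weight_sub_le hδ y (Pi.single k a) (le_trans (le_of_eq ?_) ha)
    rw [Finset.sum_eq_single k (fun j _ hj => by simp [hj]) (by simp), Pi.single_eq_same]
  simp only [hsum]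
  have e : (2 * Real.cos (Real.pi * ℓ / p) + 2 * d * Real.cos θ) *
        (b * W y * Real.cos (θ * s - α)) -
      (blockSine p ℓ (n + 1) * W y * Real.cos (θ * s - α) +
        blockSine p ℓ (n - 1) * W y * Real.cos (θ * s - α) +
        ∑ k : Fin d, (b * W (y + Pi.single k 1) * Real.cos (θ * (s + 1 : ℤ) - α) +
          b * W (y + Pi.single k (-1)) * Real.cos (θ * (s + -1 : ℤ) - α))) =
      -b * ∑ k : Fin d, ((W (y + Pi.single k 1) - W y) * Real.cos (θ * (s + 1 : ℤ) - α) +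
          (W (y + Pi.single k (-1)) - W y) * Real.cos (θ * (s + -1 : ℤ) - α)) := by
    have hcos : Real.cos (θ * (s + 1 : ℤ) - α) + Real.cos (θ * (s + -1 : ℤ) - α) =
        2 * Real.cos θ * Real.cos (θ * s - α) := by
      rw [show θ * (s + 1 : ℤ) - α = (θ * s - α) + θ by push_cast; ring,
        show θ * (s + -1 : ℤ) - α = (θ * s - α) - θ by push_cast; ring,
        Real.cos_add (θ * s - α), Real.cos_sub (θ * s - α) θ]
      ring
    simp only [sub_mul, mul_assoc, Finset.sum_add_distrib, Finset.sum_sub_distrib,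
      Finset.sum_const, Finset.card_univ, Fintype.card_fin, nsmul_eq_mul, ← Finset.mul_sum]
    linear_combination (-W y * Real.cos (θ * s - α)) * hb - b * d * W y * hcos
  refine (congrArg abs e).trans_le ?_
  rw [abs_mul, abs_mul, abs_neg, abs_of_nonneg (show 0 ≤ W y by positivity)]
  have hbound : |∑ k : Fin d, ((W (y + Pi.single k 1) - W y) * Real.cos (θ * (s + 1 : ℤ) - α) +
      (W (y + Pi.single k (-1)) - W y) * Real.cos (θ * (s + -1 : ℤ) - α))| ≤
      ∑ k : Fin d, (δ * W y + δ * W y) := by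
    have hterm : ∀ (k : Fin d) (a : ℤ) (c : ℝ), a.natAbs ≤ 1 →
        |(W (y + Pi.single k a) - W y) * Real.cos c| ≤ δ * W y := by
      intro k a c ha
      rw [abs_mul]
      exact (mul_le_of_le_one_right (abs_nonneg _) (Real.abs_cos_le_one c)).trans (hstep k a ha)
    exact (Finset.abs_sum_le_sum_abs _ _).trans (Finset.sum_le_sum fun k _ =>
      (abs_add_le _ _).trans (add_le_add (hterm _ _ _ (by simp)) (hterm _ _ _ (by simp))))
  refine (mul_le_mul_of_nonneg_left hbound (abs_nonneg b)).trans (le_of_eq ?_)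
  simp only [Finset.sum_const, Finset.card_univ, Fintype.card_fin, nsmul_eq_mul]
  ring

theorem mem_spectrum (hH : IsTrimmedLaplacian H) {ℓ : ℕ} (hℓ : 1 ≤ ℓ) (hℓp : ℓ < p) (θ : ℝ) :
    2 * Real.cos (Real.pi * ℓ / p) + 2 * d * Real.cos θ ∈ spectrum ℝ H := by
  intro hunit
  set T := algebraMap ℝ (TrimmedSpace p d →L[ℝ] TrimmedSpace p d)
    (2 * Real.cos (Real.pi * ℓ / p) + 2 * d * Real.cos θ) - H
  obtain ⟨S, hS⟩ : ∃ S, S * T = 1 := hunit.exists_left_inv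
  set δ : ℝ := (1 + 4 * d * ‖S‖)⁻¹ with hδdef
  have hδ : 0 < δ := by positivity
  have hq0 : 0 ≤ (1 + δ)⁻¹ := by positivity
  have hmem := memℓp_weylWeight (p := p) (d := d) ℓ hq0 (inv_lt_one_of_one_lt₀ (by linarith))
  let w : TrimmedSpace p d := ⟨_, hmem⟩
  let wave : ℝ → TrimmedSpace p d := fun α =>
    ⟨fun x => w x * Real.cos (θ * (∑ j, x.1.2 j : ℤ) - α), hmem.mono' fun x => by
      rw [norm_mul]
      exact mul_le_of_le_one_right (norm_nonneg _) (Real.abs_cos_le_one _)⟩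
  have hwave : ∀ α, ‖wave α‖ ≤ ‖S‖ * (2 * d * δ * ‖w‖) := by
    intro α
    have h₁ : wave α = S (T (wave α)) := by
      rw [← mul_apply_eq_comp, hS]
      rfl
    have h₂ : ‖T (wave α)‖ ≤ ‖(2 * d * δ) • w‖ := by
      refine lp.norm_mono two_ne_zero fun x => ?_
      refine (hH.abs_sub_apply_le (by omega) ℓ hδ θ α (wave α) (fun _ => rfl) x).trans
        (le_of_eq ?_)
      rw [lp.coeFn_smul, Pi.smul_apply, norm_smul, Real.norm_of_nonneg (by positivity)]
      rfl
    rw [norm_smul, Real.norm_of_nonneg (by positivity)] at h₂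
    calc ‖wave α‖ = ‖S (T (wave α))‖ := congrArg _ h₁
      _ ≤ ‖S‖ * ‖T (wave α)‖ := S.le_opNorm _
      _ ≤ _ := mul_le_mul_of_nonneg_left h₂ (norm_nonneg S)
  let absWave : ℝ → TrimmedSpace p d := fun α => ⟨fun x => |wave α x|, (lp.memℓp (wave α)).norm⟩
  have habs : ∀ α, ‖absWave α‖ ≤ ‖wave α‖ := fun α =>
    lp.norm_mono two_ne_zero fun x => (abs_abs (wave α x)).le
  have hw : ‖w‖ ≤ ‖absWave 0 + absWave (Real.pi / 2)‖ := by
    refine lp.norm_mono two_ne_zero fun x => ?_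
    change |w x| ≤ abs (|w x * Real.cos (θ * (∑ j, x.1.2 j : ℤ) - 0)| +
      |w x * Real.cos (θ * (∑ j, x.1.2 j : ℤ) - Real.pi / 2)|)
    rw [sub_zero, Real.cos_sub_pi_div_two, abs_mul, abs_mul, ← mul_add]
    set c := θ * (∑ j, x.1.2 j : ℤ)
    refine (le_mul_of_one_le_right (abs_nonneg _) ?_).trans (le_abs_self _)
    have h₁ := Real.abs_cos_le_one c
    have h₂ := Real.abs_sin_le_one c
    have h₃ := Real.sin_sq_add_cos_sq c
    rw [← sq_abs, ← sq_abs (Real.cos c)] at h₃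
    nlinarith [abs_nonneg (Real.cos c), abs_nonneg (Real.sin c)]
  have hw0 : 0 < ‖w‖ := by
    have hnd : ¬ (p : ℤ) ∣ 1 := fun h => by
      have := Int.le_of_dvd one_pos h
      omega
    refine norm_pos_iff.2 fun h => blockSine_one_ne_zero hℓ hℓp ?_
    have h1 : w ⟨(1, 0), hnd⟩ = 0 := by rw [h]; rfl
    have h2 : w ⟨(1, 0), hnd⟩ = blockSine p ℓ 1 := by
      change weylWeight p ℓ _ 1 0 = _
      simp [weylWeight]
    rw [← h2, h1]
  have hle : ‖w‖ ≤ (4 * d * ‖S‖ * δ) * ‖w‖ := by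
    have h₁ := (habs 0).trans (hwave 0)
    have h₂ := (habs (Real.pi / 2)).trans (hwave (Real.pi / 2))
    have h₃ := hw.trans (norm_add_le _ _)
    linarith
  have hlt : 4 * d * ‖S‖ * δ < 1 := by
    rw [hδdef, ← div_eq_mul_inv, div_lt_one (by positivity)]
    linarith
  exact absurd hle (not_le.2 (mul_lt_of_lt_one_left hw0 hlt))

theorem subset_spectrum (hH : IsTrimmedLaplacian H) (hd : 1 ≤ d) :
    (⋃ ℓ ∈ Finset.Icc 1 (p - 1),
      Set.Icc (2 * Real.cos (Real.pi * ℓ / p) - 2 * d)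
              (2 * Real.cos (Real.pi * ℓ / p) + 2 * d)) ⊆ spectrum ℝ H := by
  refine Set.iUnion₂_subset fun ℓ hℓ t ht => ?_
  rw [Finset.mem_Icc] at hℓ
  have hd' : (0 : ℝ) < 2 * d := by
    have : (1 : ℝ) ≤ d := by exact_mod_cast hd
    linarith
  set μ := 2 * Real.cos (Real.pi * ℓ / p) with hμ
  have h := hH.mem_spectrum hℓ.1 (by omega) (Real.arccos ((t - μ) / (2 * d)))
  rw [Real.cos_arccos (by rw [le_div_iff₀ hd']; linarith [ht.1])
    (by rw [div_le_iff₀ hd']; linarith [ht.2]), mul_div_cancel₀ _ hd'.ne', ← hμ] at h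
  simpa using h

end IsTrimmedLaplacian

end

/-- For Γ = pℤ × ℤ^{d₂} ⊂ ℤ^{1+d₂}, the spectrum of the Laplacian on Γᶜ with simple
boundary conditions is ⋃_{ℓ=1}^{p−1} (2cos(πℓ/p) + [−2d₂, 2d₂]). -/
theorem trimmed_complement_spectrum (p d₂ : ℕ) (hp : 2 ≤ p) (hd₂ : 1 ≤ d₂)
    (Hc : lp (fun _ : {z : ℤ × (Fin d₂ → ℤ) // ¬ (p : ℤ) ∣ z.1} => ℝ) 2 →L[ℝ]
          lp (fun _ : {z : ℤ × (Fin d₂ → ℤ) // ¬ (p : ℤ) ∣ z.1} => ℝ) 2)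
    (hHc : ∀ (u : lp (fun _ : {z : ℤ × (Fin d₂ → ℤ) // ¬ (p : ℤ) ∣ z.1} => ℝ) 2)
        (x : {z : ℤ × (Fin d₂ → ℤ) // ¬ (p : ℤ) ∣ z.1}),
      Hc u x =
        ((if h : ¬ (p : ℤ) ∣ ((↑x : ℤ × (Fin d₂ → ℤ)).1 + 1) then
            u ⟨((↑x : ℤ × (Fin d₂ → ℤ)).1 + 1, (↑x : ℤ × (Fin d₂ → ℤ)).2), h⟩ else 0) +
         (if h : ¬ (p : ℤ) ∣ ((↑x : ℤ × (Fin d₂ → ℤ)).1 - 1) then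
            u ⟨((↑x : ℤ × (Fin d₂ → ℤ)).1 - 1, (↑x : ℤ × (Fin d₂ → ℤ)).2), h⟩ else 0)) +
        ∑ k : Fin d₂,
          (u ⟨((↑x : ℤ × (Fin d₂ → ℤ)).1,
              Function.update (↑x : ℤ × (Fin d₂ → ℤ)).2 k ((↑x : ℤ × (Fin d₂ → ℤ)).2 k + 1)),
              x.2⟩ +
           u ⟨((↑x : ℤ × (Fin d₂ → ℤ)).1,
              Function.update (↑x : ℤ × (Fin d₂ → ℤ)).2 k ((↑x : ℤ × (Fin d₂ → ℤ)).2 k - 1)),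
              x.2⟩)) :
    spectrum ℝ Hc = ⋃ ℓ ∈ Finset.Icc 1 (p - 1),
      Set.Icc (2 * Real.cos (Real.pi * ℓ / p) - 2 * d₂)
              (2 * Real.cos (Real.pi * ℓ / p) + 2 * d₂) := by
  have hH : IsTrimmedLaplacian Hc := fun u x => by
    rw [hHc]
    have hup : ∀ (k : Fin d₂) (a : ℤ),
        Function.update x.1.2 k (x.1.2 k + a) = x.1.2 + Pi.single k a := by
      intro k a
      ext j
      obtain rfl | hj := eq_or_ne j k <;> simp [*]
    simp only [sub_eq_add_neg _ (1 : ℤ), hup]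
    rfl
  exact (hH.spectrum_subset hp).antisymm (hH.subset_spectrum hd₂)
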